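/- arXiv:2306.07452 — 2 statements merged into one kernel-verified Lean document; each statement's English description precedes it below -/
import Mathlib

section
/- Let m > 2 and let 0 < r < (m-2)/m. Consider the annular domain Ω = {x ∈ ℝ^m : r < ‖x‖ < 1}. Then: (i) d_{∂Ω}(x) = ‖x‖ - r for all x with r < ‖x‖ < (1+r)/2; (ii) for ‖x‖ > r one has Δ(-log(‖x‖ - r)) = ((m-1)r - (m-2)‖x‖)/(‖x‖(‖x‖ - r)²), which is negative whenever (m-1)r/(m-2) < ‖x‖ < (1+r)/2; consequently the function x ↦ -log(d_{∂Ω}(x)) is not subharmonic on Ω. -/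
open MeasureTheory Metric Filter Topology Set
open scoped ENNReal

noncomputable section

/-- The positive part of an extended real number, as an extended nonnegative real. -/
def erealToENNReal (x : EReal) : ℝ≥0∞ := if x = ⊤ then ⊤ else ENNReal.ofReal x.toReal

variable {E : Type*} [NormedAddCommGroup E] [MeasureSpace E]

/-- The mean value `M_u(x,r)` of an extended-real-valued function `u` over the ball `B(x,r)`,
computed as the difference of the integrals of the positive and negative parts. -/
def erealBallAvg (u : E → EReal) (x : E) (r : ℝ) : EReal :=
  (((∫⁻ y in ball x r, erealToENNReal (u y)) / volume (ball x r) : ℝ≥0∞) : EReal)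
    - (((∫⁻ y in ball x r, erealToENNReal (-(u y))) / volume (ball x r) : ℝ≥0∞) : EReal)

/-- The sub-mean value property on a set `s`: at each point of `s` the value of `u` is at most
its average over every sufficiently small ball centered at the point and contained in `s`. -/
def SubmeanOn (u : E → EReal) (s : Set E) : Prop :=
  ∀ x ∈ s, ∃ R > 0, ∀ r : ℝ, 0 < r → r < R → closedBall x r ⊆ s →
    u x ≤ erealBallAvg u x r

/-- `u : E → [-∞,∞)` is subharmonic on `s` if it is upper semicontinuous on `s`, not
identically `-∞` on `s`, takes values in `[-∞,∞)`, and satisfies the sub-mean value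
inequality on `s`. -/
def IsSubharmonicOn (u : E → EReal) (s : Set E) : Prop :=
  UpperSemicontinuousOn u s ∧ (¬ ∀ x ∈ s, u x = ⊥) ∧ (∀ x ∈ s, u x < ⊤) ∧ SubmeanOn u s

/-- The Laplacian of `u : ℝᵐ → ℝ` at `x`: the sum of the pure second derivatives in the
coordinate directions. -/
def lap {m : ℕ} (u : EuclideanSpace ℝ (Fin m) → ℝ) (x : EuclideanSpace ℝ (Fin m)) : ℝ :=
  ∑ i : Fin m,
    fderiv ℝ (fun y => fderiv ℝ u y (EuclideanSpace.single i (1 : ℝ))) x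
      (EuclideanSpace.single i (1 : ℝ))

open scoped RealInnerProductSpace

/-- The mean value of a real-valued integrable function, computed in `EReal`, is the usual one. -/
lemma erealBallAvg_coe {m : ℕ} (f : EuclideanSpace ℝ (Fin m) → ℝ)
    (x : EuclideanSpace ℝ (Fin m)) {δ : ℝ} (hδ : 0 < δ) (hf : IntegrableOn f (ball x δ)) :
    erealBallAvg (fun y => (f y : EReal)) x δ
      = (((∫ y in ball x δ, f y) / volume.real (ball x δ) : ℝ) : EReal) := by
  have hV0 : volume (ball x δ) ≠ 0 := (measure_ball_pos volume x hδ).ne'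
  have key : ∀ g : EuclideanSpace ℝ (Fin m) → ℝ, IntegrableOn g (ball x δ) →
      (((∫⁻ y in ball x δ, ENNReal.ofReal (g y)) / volume (ball x δ) : ℝ≥0∞) : EReal)
        = (((∫⁻ y in ball x δ, ENNReal.ofReal (g y)).toReal / volume.real (ball x δ) : ℝ)
            : EReal) := by
    intro g hg
    have hfin : (∫⁻ y in ball x δ, ENNReal.ofReal (g y)) ≠ ⊤ := hg.lintegral_lt_top.ne
    rw [← EReal.coe_ennreal_toReal (ENNReal.div_ne_top hfin hV0), ENNReal.toReal_div]
    rfl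
  have h1 : ∀ y, erealToENNReal (f y : EReal) = ENNReal.ofReal (f y) := by
    intro y; simp [erealToENNReal]
  have h2 : ∀ y, erealToENNReal (-(f y : EReal)) = ENNReal.ofReal (-f y) := by
    intro y
    rw [← EReal.coe_neg]
    simp only [erealToENNReal, EReal.coe_ne_top, if_false, EReal.toReal_coe]
  unfold erealBallAvg
  simp only [h1, h2]
  rw [key f hf, key (fun y => -f y) hf.neg, ← EReal.coe_sub, ← sub_div,
    integral_eq_lintegral_pos_part_sub_lintegral_neg_part hf]

/-- The integral of an odd function over a centered ball vanishes. -/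
lemma integral_ball_zero_of_odd {m : ℕ} (f : EuclideanSpace ℝ (Fin m) → ℝ)
    (hf : ∀ h, f (-h) = -f h) (δ : ℝ) : ∫ h in ball 0 δ, f h = 0 := by
  have h1 := (Measure.measurePreserving_neg
    (volume : Measure (EuclideanSpace ℝ (Fin m)))).setIntegral_preimage_emb
      (MeasurableEquiv.neg _).measurableEmbedding f (ball 0 δ)
  simp only [neg_preimage, neg_ball, neg_zero, hf, integral_neg] at h1
  linarith

lemma Continuous.integrableOn_ball_euclidean {m : ℕ} {f : EuclideanSpace ℝ (Fin m) → ℝ}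
    (hf : Continuous f) (x : EuclideanSpace ℝ (Fin m)) (δ : ℝ) : IntegrableOn f (ball x δ) :=
  (hf.continuousOn.integrableOn_compact (isCompact_closedBall x δ)).mono_set
    ball_subset_closedBall

lemma integral_ball_inner_sq_eq_of_norm_eq {m : ℕ} {a b : EuclideanSpace ℝ (Fin m)}
    (hab : ‖a‖ = ‖b‖) (δ : ℝ) :
    ∫ h in ball 0 δ, ⟪a, h⟫ ^ 2 = ∫ h in ball 0 δ, ⟪b, h⟫ ^ 2 := by
  set φ := (ℝ ∙ (a - b))ᗮ.reflection with hφ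
  have h0 : φ a = b := Submodule.reflection_sub hab
  have h1 := φ.measurePreserving.setIntegral_preimage_emb
    φ.toHomeomorph.measurableEmbedding (fun h => ⟪b, h⟫ ^ 2) (ball 0 δ)
  rw [← h1, φ.preimage_ball, map_zero]
  simp only [← h0, φ.inner_map_map]

/-- By rotation invariance, `⟪a, h⟫ ^ 2` integrates like `‖a‖ ^ 2 * ‖h‖ ^ 2 / m`. -/
lemma integral_ball_inner_sq {m : ℕ} (a : EuclideanSpace ℝ (Fin m)) (δ : ℝ) :
    m * ∫ h in ball 0 δ, ⟪a, h⟫ ^ 2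
      = ‖a‖ ^ 2 * ∫ h in ball (0 : EuclideanSpace ℝ (Fin m)) δ, ‖h‖ ^ 2 := by
  have h1 : ∀ i : Fin m, ∫ h in ball 0 δ, ⟪a, h⟫ ^ 2
      = ∫ h in ball (0 : EuclideanSpace ℝ (Fin m)) δ, ‖a‖ ^ 2 * (h i) ^ 2 := by
    intro i
    rw [integral_ball_inner_sq_eq_of_norm_eq
      (b := EuclideanSpace.single i ‖a‖) (by simp) δ]
    congr 1
    ext h
    simp [EuclideanSpace.inner_single_left, mul_pow]
  have h2 : ∑ _i : Fin m, ∫ h in ball 0 δ, ⟪a, h⟫ ^ 2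
      = m * ∫ h in ball 0 δ, ⟪a, h⟫ ^ 2 := by simp
  rw [← h2, Finset.sum_congr rfl fun i _ => h1 i, ← integral_finsetSum, ← integral_const_mul]
  · simp only [EuclideanSpace.real_norm_sq_eq, Finset.mul_sum]
  · intro i _
    exact Continuous.integrableOn_ball_euclidean (by fun_prop) _ _

lemma integral_ball_norm_sq_pos {m : ℕ} (hm : 0 < m) {δ : ℝ} (hδ : 0 < δ) :
    0 < ∫ h in ball (0 : EuclideanSpace ℝ (Fin m)) δ, ‖h‖ ^ 2 := by
  have : Nonempty (Fin m) := ⟨⟨0, hm⟩⟩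
  rw [setIntegral_pos_iff_support_of_nonneg_ae (Eventually.of_forall fun h => by positivity)
    (Continuous.integrableOn_ball_euclidean (by fun_prop) _ _)]
  have : (Function.support fun h : EuclideanSpace ℝ (Fin m) => ‖h‖ ^ 2) ∩ ball 0 δ
      = ball 0 δ \ {0} := by
    ext h; simp [and_comm]
  rw [this, measure_sdiff_null (measure_singleton _)]
  exact measure_ball_pos _ _ hδ

/-- A function lying below `c + A (‖y‖² - ‖x‖²) + K (‖y‖² - ‖x‖²)²` has small mean over balls
around `x` as soon as this quadratic expression has negative Laplacian at `x`. -/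
lemma setIntegral_ball_lt {m : ℕ} (hm : 0 < m) {f : EuclideanSpace ℝ (Fin m) → ℝ}
    {x : EuclideanSpace ℝ (Fin m)} {δ c A K : ℝ} (hδ : 0 < δ) (hK : 0 ≤ K)
    (hf : IntegrableOn f (ball x δ))
    (hle : ∀ y ∈ ball x δ,
      f y ≤ c + A * (‖y‖ ^ 2 - ‖x‖ ^ 2) + K * (‖y‖ ^ 2 - ‖x‖ ^ 2) ^ 2)
    (hneg : A + 4 * K * ‖x‖ ^ 2 / m + K * δ ^ 2 < 0) :
    ∫ y in ball x δ, f y < c * volume.real (ball x δ) := by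
  have hm' : (0 : ℝ) < m := by exact_mod_cast hm
  set M := ∫ h in ball (0 : EuclideanSpace ℝ (Fin m)) δ, ‖h‖ ^ 2 with hM
  have hMpos : 0 < M := integral_ball_norm_sq_pos hm hδ
  have hgi : ∀ {g : EuclideanSpace ℝ (Fin m) → ℝ}, Continuous g → IntegrableOn g (ball 0 δ) :=
    fun hg => hg.integrableOn_ball_euclidean _ _
  have htrans : ∫ y in ball x δ, (c + A * (‖y‖ ^ 2 - ‖x‖ ^ 2) + K * (‖y‖ ^ 2 - ‖x‖ ^ 2) ^ 2)
      = ∫ h in ball (0 : EuclideanSpace ℝ (Fin m)) δ,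
        (c + A * (‖x + h‖ ^ 2 - ‖x‖ ^ 2) + K * (‖x + h‖ ^ 2 - ‖x‖ ^ 2) ^ 2) := by
    have h1 := (measurePreserving_add_left volume x).setIntegral_preimage_emb
      (MeasurableEquiv.addLeft x).measurableEmbedding
      (fun y => c + A * (‖y‖ ^ 2 - ‖x‖ ^ 2) + K * (‖y‖ ^ 2 - ‖x‖ ^ 2) ^ 2) (ball x δ)
    rw [← h1, preimage_add_ball, sub_self]
  have hbound : ∫ h in ball (0 : EuclideanSpace ℝ (Fin m)) δ,
        (c + A * (‖x + h‖ ^ 2 - ‖x‖ ^ 2) + K * (‖x + h‖ ^ 2 - ‖x‖ ^ 2) ^ 2)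
      ≤ ∫ h in ball (0 : EuclideanSpace ℝ (Fin m)) δ,
        (c + ((A + K * δ ^ 2) * ‖h‖ ^ 2 + (4 * K * ⟪x, h⟫ ^ 2
          + (2 * A * ⟪x, h⟫ + 4 * K * (⟪x, h⟫ * ‖h‖ ^ 2))))) := by
    refine setIntegral_mono_on (hgi (by fun_prop)) (hgi (by fun_prop)) measurableSet_ball ?_
    intro h hh
    have hh' : ‖h‖ ^ 2 ≤ δ ^ 2 := by
      have : ‖h‖ < δ := by simpa using hh
      gcongr
    have h4 : K * (‖h‖ ^ 2 * ‖h‖ ^ 2) ≤ K * (δ ^ 2 * ‖h‖ ^ 2) := by gcongr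
    rw [norm_add_sq_real]
    nlinarith [h4]
  have hodd : ∫ h in ball 0 δ, (2 * A * ⟪x, h⟫ + 4 * K * (⟪x, h⟫ * ‖h‖ ^ 2)) = 0 :=
    integral_ball_zero_of_odd _ (fun h => by simp only [inner_neg_right, norm_neg]; ring) δ
  have hV : volume.real (ball (0 : EuclideanSpace ℝ (Fin m)) δ) = volume.real (ball x δ) := by
    simp only [measureReal_def, Measure.addHaar_ball_center volume x δ]
  have hsq : ∫ h in ball 0 δ, ⟪x, h⟫ ^ 2 = ‖x‖ ^ 2 * M / m := by
    rw [eq_div_iff hm'.ne', mul_comm, integral_ball_inner_sq]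
  calc ∫ y in ball x δ, f y
      ≤ ∫ y in ball x δ, (c + A * (‖y‖ ^ 2 - ‖x‖ ^ 2) + K * (‖y‖ ^ 2 - ‖x‖ ^ 2) ^ 2) :=
        setIntegral_mono_on hf (Continuous.integrableOn_ball_euclidean (by fun_prop) _ _)
          measurableSet_ball hle
    _ ≤ _ := htrans.trans_le hbound
    _ = c * volume.real (ball x δ) + (A + 4 * K * ‖x‖ ^ 2 / m + K * δ ^ 2) * M := by
        rw [integral_add (hgi (by fun_prop)) (hgi (by fun_prop)),
          integral_add (hgi (by fun_prop)) (hgi (by fun_prop)),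
          integral_add (hgi (by fun_prop)) (hgi (by fun_prop)), hodd,
          integral_const_mul, integral_const_mul, hsq, setIntegral_const, smul_eq_mul, hV]
        ring
    _ < c * volume.real (ball x δ) := by nlinarith [mul_neg_of_neg_of_pos hneg hMpos]

/-- Second-order Taylor upper bound with a slightly enlarged quadratic coefficient. -/
lemma eventually_le_quadratic {ψ ψ₁ : ℝ → ℝ} {s d K : ℝ}
    (h1 : ∀ᶠ t in 𝓝 s, HasDerivAt ψ (ψ₁ t) t) (h2 : HasDerivAt ψ₁ d s) (hK : d < 2 * K) :
    ∀ᶠ t in 𝓝 s, ψ t ≤ ψ s + ψ₁ s * (t - s) + K * (t - s) ^ 2 := by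
  set D : ℝ → ℝ := fun t => ψ s + ψ₁ s * (t - s) + K * (t - s) ^ 2 - ψ t with hD
  have hD1 : ∀ᶠ t in 𝓝 s, HasDerivAt D (ψ₁ s + 2 * K * (t - s) - ψ₁ t) t := by
    filter_upwards [h1] with t ht
    have hid : HasDerivAt (fun t : ℝ => t - s) 1 t := (hasDerivAt_id t).sub_const s
    exact ((((hid.const_mul (ψ₁ s)).const_add (ψ s)).add
      ((hid.fun_pow 2).const_mul K)).sub ht).congr_deriv (by push_cast; ring)
  have hderiv : deriv D =ᶠ[𝓝 s] fun t => ψ₁ s + 2 * K * (t - s) - ψ₁ t :=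
    hD1.mono fun t ht => ht.deriv
  have hD2 : deriv (deriv D) s = 2 * K - d := by
    rw [hderiv.deriv_eq]
    have hid : HasDerivAt (fun t : ℝ => t - s) 1 s := (hasDerivAt_id s).sub_const s
    simpa using (((hid.const_mul (2 * K)).const_add (ψ₁ s)).fun_sub h2).deriv
  have hmin : IsLocalMin D s := by
    refine isLocalMin_of_deriv_deriv_pos (by rw [hD2]; linarith) ?_
      hD1.self_of_nhds.continuousAt
    rw [hderiv.self_of_nhds]; ring
  filter_upwards [hmin] with t ht
  have h0 : D s = 0 := by simp [hD]
  rw [h0] at ht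
  simp only [hD] at ht
  linarith

/-- The Laplacian of a function of `‖y‖ ^ 2`. -/
lemma lap_comp_norm_sq {m : ℕ} {ψ ψ₁ : ℝ → ℝ} {d : ℝ} {x : EuclideanSpace ℝ (Fin m)}
    (h1 : ∀ᶠ t in 𝓝 (‖x‖ ^ 2), HasDerivAt ψ (ψ₁ t) t) (h2 : HasDerivAt ψ₁ d (‖x‖ ^ 2)) :
    lap (fun y => ψ (‖y‖ ^ 2)) x = 2 * m * ψ₁ (‖x‖ ^ 2) + 4 * ‖x‖ ^ 2 * d := by
  have hsq : ∀ y : EuclideanSpace ℝ (Fin m),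
      HasFDerivAt (fun y : EuclideanSpace ℝ (Fin m) => ‖y‖ ^ 2) (2 • innerSL ℝ y) y :=
    fun y => (hasStrictFDerivAt_norm_sq y).hasFDerivAt
  have hcont : Tendsto (fun y : EuclideanSpace ℝ (Fin m) => ‖y‖ ^ 2) (𝓝 x) (𝓝 (‖x‖ ^ 2)) :=
    (by fun_prop : Continuous fun y : EuclideanSpace ℝ (Fin m) => ‖y‖ ^ 2).tendsto x
  have hfirst : ∀ i : Fin m,
      (fun y => fderiv ℝ (fun y => ψ (‖y‖ ^ 2)) y (EuclideanSpace.single i (1 : ℝ)))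
        =ᶠ[𝓝 x] fun y => ψ₁ (‖y‖ ^ 2) * (2 * y i) := by
    intro i
    filter_upwards [hcont.eventually h1] with y hy
    have h3 : HasFDerivAt (fun y => ψ (‖y‖ ^ 2)) _ y := hy.comp_hasFDerivAt y (hsq y)
    rw [h3.fderiv]
    simp [EuclideanSpace.inner_single_right]
  have hsecond : ∀ i : Fin m,
      fderiv ℝ (fun y => fderiv ℝ (fun y => ψ (‖y‖ ^ 2)) y (EuclideanSpace.single i (1 : ℝ))) x
        (EuclideanSpace.single i (1 : ℝ)) = 2 * ψ₁ (‖x‖ ^ 2) + 4 * d * x i ^ 2 := by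
    intro i
    have hc : HasFDerivAt (fun y : EuclideanSpace ℝ (Fin m) => 2 * y i)
        ((2 : ℝ) • (EuclideanSpace.proj i : EuclideanSpace ℝ (Fin m) →L[ℝ] ℝ)) x :=
      (EuclideanSpace.proj i : EuclideanSpace ℝ (Fin m) →L[ℝ] ℝ).hasFDerivAt.const_mul 2
    have h3 := (h2.comp_hasFDerivAt x (hsq x)).mul hc
    rw [(hfirst i).fderiv_eq]
    erw [h3.fderiv]
    simp [EuclideanSpace.inner_single_right]
    ring
  unfold lap
  rw [Finset.sum_congr rfl fun i _ => hsecond i, Finset.sum_add_distrib, ← Finset.mul_sum _ _ (4 * d),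
    ← EuclideanSpace.real_norm_sq_eq]
  simp
  ring

lemma hasDerivAt_neg_log_sqrt_sub {r s : ℝ} (hr : 0 < r) (hs : r ^ 2 < s) :
    HasDerivAt (fun t => -Real.log (√t - r)) (-(2 * (√s * (√s - r)))⁻¹) s := by
  have h1 : r < √s := Real.lt_sqrt_of_sq_lt hs
  have h2 : 0 < √s - r := by linarith
  have hs0 : 0 < √s := by linarith
  have hsp : s ≠ 0 := by nlinarith
  refine (((Real.hasDerivAt_sqrt hsp).sub_const r).log h2.ne').neg.congr_deriv ?_
  field_simp

lemma hasDerivAt_neg_inv_sqrt_mul {r s : ℝ} (hr : 0 < r) (hs : r ^ 2 < s) :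
    HasDerivAt (fun t => -(2 * (√t * (√t - r)))⁻¹)
      ((2 * √s - r) / (4 * √s ^ 3 * (√s - r) ^ 2)) s := by
  have h1 : r < √s := Real.lt_sqrt_of_sq_lt hs
  have h2 : 0 < √s - r := by linarith
  have hs0 : 0 < √s := by linarith
  have hsp : s ≠ 0 := by nlinarith
  have hd := Real.hasDerivAt_sqrt hsp
  refine (((hd.fun_mul (hd.sub_const r)).const_mul 2).fun_inv (by positivity)).neg.congr_deriv ?_
  field_simp
  ring

lemma infDist_frontier_annulus {m : ℕ} {r : ℝ} (hr0 : 0 < r)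
    {x : EuclideanSpace ℝ (Fin m)} (hx : r < ‖x‖) (hx' : ‖x‖ < (1 + r) / 2) :
    infDist x (frontier {x : EuclideanSpace ℝ (Fin m) | r < ‖x‖ ∧ ‖x‖ < 1}) = ‖x‖ - r := by
  set Ω := {x : EuclideanSpace ℝ (Fin m) | r < ‖x‖ ∧ ‖x‖ < 1} with hΩ
  have hopen : IsOpen Ω :=
    (isOpen_lt continuous_const continuous_norm).inter (isOpen_lt continuous_norm continuous_const)
  have hfr : frontier Ω = closure Ω \ Ω := hopen.frontier_eq
  have hx0 : 0 < ‖x‖ := hr0.trans hx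
  have hcl : closure Ω ⊆ {y | r ≤ ‖y‖ ∧ ‖y‖ ≤ 1} :=
    closure_minimal (fun y hy => ⟨hy.1.le, hy.2.le⟩)
      ((isClosed_le continuous_const continuous_norm).inter
        (isClosed_le continuous_norm continuous_const))
  have hnorm : ∀ t : ℝ, 0 ≤ t → ‖(t / ‖x‖) • x‖ = t := by
    intro t ht
    rw [norm_smul, Real.norm_of_nonneg (by positivity)]
    field_simp
  have hp : (r / ‖x‖) • x ∈ frontier Ω := by
    rw [hfr]
    refine ⟨?_, fun h => ?_⟩
    · have hcont : Continuous fun t : ℝ => (t / ‖x‖) • x := by fun_prop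
      refine mem_closure_of_tendsto ((hcont.tendsto r).mono_left
        (nhdsWithin_le_nhds (s := Ioi r))) ?_
      filter_upwards [Ioo_mem_nhdsGT (show r < 1 by linarith)] with t ht
      have := hnorm t (by linarith [ht.1])
      exact ⟨by rw [this]; exact ht.1, by rw [this]; exact ht.2⟩
    · have := h.1
      rw [hnorm r hr0.le] at this
      exact lt_irrefl _ this
  apply le_antisymm
  · refine (infDist_le_dist_of_mem hp).trans_eq ?_
    have : x - (r / ‖x‖) • x = ((‖x‖ - r) / ‖x‖) • x := by
      rw [sub_div, div_self hx0.ne', sub_smul, one_smul]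
    rw [dist_eq_norm, this, hnorm _ (by linarith)]
  · refine (le_infDist ⟨_, hp⟩).2 fun y hy => ?_
    rw [hfr] at hy
    obtain ⟨h1, h2⟩ := hcl hy.1
    have h3 : ¬ (r < ‖y‖ ∧ ‖y‖ < 1) := hy.2
    have h4 := abs_norm_sub_norm_le x y
    rw [← dist_eq_norm] at h4
    have h5 := abs_le.1 h4
    by_cases h : r < ‖y‖
    · have : 1 ≤ ‖y‖ := by by_contra hc; exact h3 ⟨h, not_le.1 hc⟩
      linarith [h5.1]
    · linarith [h5.2, not_lt.1 h]

lemma annulus_laplacian_neg {m : ℕ} (hm : 2 < m) {r ρ : ℝ} (hr0 : 0 < r)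
    (hρ : ((m : ℝ) - 1) * r / ((m : ℝ) - 2) < ρ) :
    r < ρ ∧ (((m : ℝ) - 1) * r - ((m : ℝ) - 2) * ρ) / (ρ * (ρ - r) ^ 2) < 0 := by
  have hm' : (0 : ℝ) < m - 2 := by
    have : (2 : ℝ) < m := by exact_mod_cast hm
    linarith
  rw [div_lt_iff₀ hm'] at hρ
  have h1 : r < ρ := by nlinarith
  have h2 : 0 < ρ - r := by linarith
  have h3 : 0 < ρ := by linarith
  exact ⟨h1, div_neg_of_neg_of_pos (by linarith) (by positivity)⟩

lemma not_submeanOn_annulus {m : ℕ} (hm : 2 < m) {r : ℝ} (hr0 : 0 < r)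
    (hr1 : r < ((m : ℝ) - 2) / m) {Ω : Set (EuclideanSpace ℝ (Fin m))}
    (hΩ : Ω = {x : EuclideanSpace ℝ (Fin m) | r < ‖x‖ ∧ ‖x‖ < 1}) :
    ¬ SubmeanOn (fun x => ((- Real.log (infDist x (frontier Ω)) : ℝ) : EReal)) Ω := by
  intro hsub
  have hm0 : 0 < m := by omega
  have hmR : (2 : ℝ) < m := by exact_mod_cast hm
  rw [lt_div_iff₀ (by linarith)] at hr1
  have hr2 : r < 1 := by nlinarith
  obtain ⟨ρ, hρ1, hρ2⟩ : ∃ ρ, ((m : ℝ) - 1) * r / ((m : ℝ) - 2) < ρ ∧ ρ < (1 + r) / 2 := by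
    apply exists_between
    rw [div_lt_iff₀ (by linarith)]
    nlinarith
  obtain ⟨hrρ, hneg⟩ := annulus_laplacian_neg hm hr0 hρ1
  have hρ0 : 0 < ρ := by linarith
  have hρr : 0 < ρ - r := by linarith
  obtain ⟨x, hx⟩ : ∃ x : EuclideanSpace ℝ (Fin m), ‖x‖ = ρ :=
    ⟨EuclideanSpace.single ⟨0, hm0⟩ ρ, by simp [hρ0.le]⟩
  set A : ℝ := -(2 * (ρ * (ρ - r)))⁻¹ with hA
  set d : ℝ := (2 * ρ - r) / (4 * ρ ^ 3 * (ρ - r) ^ 2) with hd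
  have hd0 : 0 < d := div_pos (by linarith) (by positivity)
  have hlap : A + 2 * d * ρ ^ 2 / m < 0 := by
    have : A + 2 * d * ρ ^ 2 / m
        = (((m : ℝ) - 1) * r - ((m : ℝ) - 2) * ρ) / (ρ * (ρ - r) ^ 2) / (2 * m) := by
      rw [hA, hd]
      field_simp
      ring
    rw [this]
    exact div_neg_of_neg_of_pos hneg (by linarith)
  obtain ⟨K, hK1, hK2⟩ : ∃ K, d < 2 * K ∧ A + 4 * K * ρ ^ 2 / m < 0 := by
    have hc : Continuous fun K : ℝ => A + 4 * K * ρ ^ 2 / m := by fun_prop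
    have h0 : ∀ᶠ K in 𝓝 (d / 2), A + 4 * K * ρ ^ 2 / m < 0 := by
      refine hc.continuousAt.eventually_lt continuousAt_const ?_
      exact hlap.trans_eq' (by ring)
    have h1 : ∀ᶠ K in 𝓝[>] (d / 2), d < 2 * K := by
      filter_upwards [self_mem_nhdsWithin] with K hK
      have : d / 2 < K := hK
      linarith
    exact (h1.and (h0.filter_mono nhdsWithin_le_nhds)).exists
  have hK0 : 0 < K := by linarith
  have hρsq : √(ρ ^ 2) = ρ := Real.sqrt_sq hρ0.le
  have hder1 : ∀ᶠ t in 𝓝 (ρ ^ 2),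
      HasDerivAt (fun t => -Real.log (√t - r)) (-(2 * (√t * (√t - r)))⁻¹) t := by
    filter_upwards [lt_mem_nhds (show r ^ 2 < ρ ^ 2 by gcongr)] with t ht
    exact hasDerivAt_neg_log_sqrt_sub hr0 ht
  have hder2 := hasDerivAt_neg_inv_sqrt_mul hr0 (show r ^ 2 < ρ ^ 2 by gcongr)
  have hquad := eventually_le_quadratic (K := K) hder1 hder2 (by rw [hρsq]; exact hK1)
  rw [hρsq] at hquad
  have hcsq : Continuous fun y : EuclideanSpace ℝ (Fin m) => ‖y‖ ^ 2 := by fun_prop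
  have hE : ∀ᶠ y in 𝓝 x, (r < ‖y‖ ∧ ‖y‖ < (1 + r) / 2) ∧
      -Real.log (√(‖y‖ ^ 2) - r) ≤ -Real.log (ρ - r) + A * (‖y‖ ^ 2 - ρ ^ 2)
        + K * (‖y‖ ^ 2 - ρ ^ 2) ^ 2 := by
    refine ((continuous_norm.continuousAt.eventually_mem (Ioo_mem_nhds ?_ ?_))).and
      ((hcsq.tendsto x).eventually (by rw [hx]; exact hquad))
    · rw [hx]; exact hrρ
    · rw [hx]; exact hρ2
  obtain ⟨ε, hε, hball⟩ := Metric.eventually_nhds_iff_ball.1 hE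
  obtain ⟨R, hR, hmean⟩ := hsub x (by rw [hΩ]; exact ⟨by linarith, by linarith⟩)
  obtain ⟨δ, ⟨hδ1, hδ2⟩, hδ3⟩ :
      ∃ δ : ℝ, (δ < min R ε ∧ A + 4 * K * ρ ^ 2 / m + K * δ ^ 2 < 0) ∧ 0 < δ := by
    have hc : Continuous fun δ : ℝ => A + 4 * K * ρ ^ 2 / m + K * δ ^ 2 := by fun_prop
    have h0 : ∀ᶠ δ in 𝓝 (0 : ℝ), A + 4 * K * ρ ^ 2 / m + K * δ ^ 2 < 0 :=
      hc.continuousAt.eventually_lt continuousAt_const (by simpa using hK2)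
    have h1 : ∀ᶠ δ in 𝓝 (0 : ℝ), δ < min R ε := gt_mem_nhds (lt_min hR hε)
    have h2 : ∀ᶠ δ in 𝓝[>] (0 : ℝ), 0 < δ := self_mem_nhdsWithin
    exact (((h1.and h0).filter_mono nhdsWithin_le_nhds).and h2).exists
  have hcb : closedBall x δ ⊆ ball x ε :=
    closedBall_subset_ball (hδ1.trans_le (min_le_right _ _))
  have hdist : ∀ y ∈ closedBall x δ, infDist y (frontier Ω) = ‖y‖ - r := fun y hy => by
    have := (hball y (hcb hy)).1
    rw [hΩ]
    exact infDist_frontier_annulus hr0 this.1 this.2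
  have hle := hmean δ hδ3 (hδ1.trans_le (min_le_left _ _)) fun y hy => by
    have := (hball y (hcb hy)).1
    rw [hΩ]
    exact ⟨this.1, by linarith [this.2]⟩
  have hgi : IntegrableOn (fun y => -Real.log (infDist y (frontier Ω))) (ball x δ) := by
    refine IntegrableOn.mono_set ?_ ball_subset_closedBall
    refine ContinuousOn.integrableOn_compact (isCompact_closedBall x δ) ?_
    refine ((continuous_infDist_pt _).continuousOn.log fun y hy => ?_).neg
    rw [hdist y hy]
    linarith [(hball y (hcb hy)).1.1]
  have hVpos : 0 < volume.real (ball x δ) :=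
    ENNReal.toReal_pos (measure_ball_pos _ _ hδ3).ne' measure_ball_lt_top.ne
  rw [erealBallAvg_coe _ _ hδ3 hgi, EReal.coe_le_coe_iff, hdist x (mem_closedBall_self hδ3.le),
    hx, le_div_iff₀ hVpos]
    at hle
  refine hle.not_gt (setIntegral_ball_lt hm0 hδ3 hK0.le hgi (A := A) (K := K) ?_ ?_)
  · intro y hy
    have := (hball y (hcb (ball_subset_closedBall hy))).2
    rw [Real.sqrt_sq (norm_nonneg _)] at this
    rw [hdist y (ball_subset_closedBall hy), hx]
    exact this
  · rw [hx]; exact hδ2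

/-- Theorem (statement 7): for `m > 2`, `0 < r < (m-2)/m` and the annulus
`Ω = {x ∈ ℝᵐ : r < ‖x‖ < 1}`: (i) `d_{∂Ω}(x) = ‖x‖ - r` for `r < ‖x‖ < (1+r)/2`;
(ii) `Δ(-log(‖x‖-r)) = ((m-1)r - (m-2)‖x‖)/(‖x‖(‖x‖-r)²)` for `‖x‖ > r`, which is negative
for `(m-1)r/(m-2) < ‖x‖ < (1+r)/2`; consequently `x ↦ -log(d_{∂Ω}(x))` is not subharmonic
on `Ω`. -/
theorem annulus_negLogDist_not_subharmonic (m : ℕ) (hm : 2 < m) (r : ℝ)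
    (hr0 : 0 < r) (hr1 : r < ((m : ℝ) - 2) / m)
    (Ω : Set (EuclideanSpace ℝ (Fin m)))
    (hΩ : Ω = {x : EuclideanSpace ℝ (Fin m) | r < ‖x‖ ∧ ‖x‖ < 1}) :
    (∀ x : EuclideanSpace ℝ (Fin m), r < ‖x‖ → ‖x‖ < (1 + r) / 2 →
        infDist x (frontier Ω) = ‖x‖ - r) ∧
    (∀ x : EuclideanSpace ℝ (Fin m), r < ‖x‖ →
        lap (fun y => - Real.log (‖y‖ - r)) x
          = (((m : ℝ) - 1) * r - ((m : ℝ) - 2) * ‖x‖) / (‖x‖ * (‖x‖ - r) ^ 2)) ∧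
    (∀ x : EuclideanSpace ℝ (Fin m),
        ((m : ℝ) - 1) * r / ((m : ℝ) - 2) < ‖x‖ → ‖x‖ < (1 + r) / 2 →
        (((m : ℝ) - 1) * r - ((m : ℝ) - 2) * ‖x‖) / (‖x‖ * (‖x‖ - r) ^ 2) < 0) ∧
    ¬ IsSubharmonicOn
        (fun x => ((- Real.log (infDist x (frontier Ω)) : ℝ) : EReal)) Ω := by
  subst hΩ
  refine ⟨fun x hx hx' => infDist_frontier_annulus hr0 hx hx', fun x hx => ?_,
    fun x hx _ => (annulus_laplacian_neg hm hr0 hx).2,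
    fun h => not_submeanOn_annulus hm hr0 hr1 rfl h.2.2.2⟩
  have hx0 : 0 < ‖x‖ := hr0.trans hx
  have hxr : 0 < ‖x‖ - r := by linarith
  have hlt : r ^ 2 < ‖x‖ ^ 2 := by gcongr
  have h1 : ∀ᶠ t in 𝓝 (‖x‖ ^ 2),
      HasDerivAt (fun t => -Real.log (√t - r)) (-(2 * (√t * (√t - r)))⁻¹) t := by
    filter_upwards [lt_mem_nhds hlt] with t ht
    exact hasDerivAt_neg_log_sqrt_sub hr0 ht
  have h2 := lap_comp_norm_sq h1 (hasDerivAt_neg_inv_sqrt_mul hr0 hlt)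
  simp only [Real.sqrt_sq (norm_nonneg _)] at h2
  rw [h2]
  field_simp
  ring

end
end

section
/- Let Ω ⊊ ℝ^m be a domain and let E ⊂ Ω be a closed subset of Ω of Lebesgue measure zero. If the function x ↦ -d_{∂Ω}(x) is subharmonic on Ω \ E, then it is subharmonic on all of Ω. -/
open MeasureTheory Metric Filter Topology Set
open scoped ENNReal

noncomputable section

variable {E : Type*} [NormedAddCommGroup E] [MeasureSpace E]

section SecondDifference

variable {H : Type*} [NormedAddCommGroup H] [InnerProductSpace ℝ H] [FiniteDimensional ℝ H]
  [MeasurableSpace H] [BorelSpace H]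

/-- The integral over the closed unit ball of the increments `u (x + ρ y) - u x`. -/
def ballIncrement (u : H → ℝ) (ρ : ℝ) (x : H) : ℝ :=
  ∫ y in closedBall (0 : H) 1, (u (x + ρ • y) - u x)

theorem continuous_ballIncrement {u : H → ℝ} (hu : Continuous u) (ρ : ℝ) :
    Continuous (ballIncrement u ρ) := by
  refine continuous_parametric_integral_of_continuous (μ := volume)
    (f := fun x y => u (x + ρ • y) - u x) ?_ (isCompact_closedBall (0 : H) 1)
  unfold Function.uncurry
  fun_prop

theorem integrableOn_closedBall_of_continuous {f : H → ℝ} (hf : Continuous f) :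
    IntegrableOn f (closedBall 0 1) :=
  hf.continuousOn.integrableOn_compact (isCompact_closedBall 0 1)

theorem setIntegral_inner_closedBall (q : H) :
    ∫ y in closedBall (0 : H) 1, inner ℝ q y = 0 := by
  have h := (LinearIsometryEquiv.neg ℝ (E := H)).measurePreserving.setIntegral_preimage_emb
    (LinearIsometryEquiv.neg ℝ (E := H)).toHomeomorph.measurableEmbedding
    (fun y => inner ℝ q y) (closedBall (0 : H) 1)
  have hs : (LinearIsometryEquiv.neg ℝ (E := H)) ⁻¹' closedBall (0 : H) 1 = closedBall 0 1 := by
    ext; simp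
  rw [hs] at h
  simp only [LinearIsometryEquiv.coe_neg, inner_neg_right, integral_neg] at h
  linarith

theorem ballIncrement_add {u v : H → ℝ} (hu : Continuous u) (hv : Continuous v) (ρ : ℝ) (x : H) :
    ballIncrement (fun z => u z + v z) ρ x = ballIncrement u ρ x + ballIncrement v ρ x := by
  unfold ballIncrement
  rw [← integral_add (integrableOn_closedBall_of_continuous (by fun_prop))
    (integrableOn_closedBall_of_continuous (by fun_prop))]
  congr 1; ext y; ring

theorem ballIncrement_const_mul_norm_sq (η ρ : ℝ) (x : H) :
    ballIncrement (fun z => η * ‖z‖ ^ 2) ρ x =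
      η * ρ ^ 2 * ∫ y in closedBall (0 : H) 1, ‖y‖ ^ 2 := by
  have h : ∀ y : H, η * ‖x + ρ • y‖ ^ 2 - η * ‖x‖ ^ 2 =
      (2 * η * ρ) * inner ℝ x y + (η * ρ ^ 2) * ‖y‖ ^ 2 := by
    intro y
    rw [norm_add_sq_real, inner_smul_right, norm_smul, mul_pow, Real.norm_eq_abs, sq_abs]
    ring
  unfold ballIncrement
  simp_rw [h]
  rw [integral_add (integrableOn_closedBall_of_continuous (by fun_prop))
    (integrableOn_closedBall_of_continuous (by fun_prop)), integral_const_mul, integral_const_mul,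
    setIntegral_inner_closedBall]
  ring

theorem setIntegral_norm_sq_closedBall_pos [Nontrivial H] :
    0 < ∫ y in closedBall (0 : H) 1, ‖y‖ ^ 2 := by
  rw [setIntegral_pos_iff_support_of_nonneg_ae (ae_of_all _ fun y => by positivity)
    (integrableOn_closedBall_of_continuous (by fun_prop))]
  obtain ⟨v, hv⟩ := exists_norm_eq H (show (0 : ℝ) ≤ 1 / 2 by norm_num)
  refine lt_of_lt_of_le (measure_ball_pos volume v (show (0 : ℝ) < 1 / 2 by norm_num))
    (measure_mono fun y hy => ?_)
  rw [mem_ball, dist_eq_norm] at hy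
  have h1 : ‖v‖ ≤ ‖v - y‖ + ‖y‖ := by simpa using norm_add_le (v - y) y
  have h2 : ‖y‖ ≤ ‖y - v‖ + ‖v‖ := by simpa using norm_add_le (y - v) v
  rw [norm_sub_rev] at h1
  refine ⟨?_, ?_⟩
  · have : 0 < ‖y‖ := by linarith
    simpa using this
  · rw [mem_closedBall_zero_iff]; linarith

/-- A quadratic lower support at `x` bounds the ball increments from below. -/
theorem neg_le_ballIncrement {u : H → ℝ} (hu : Continuous u) {x q : H} {C : ℝ} (hC : 0 ≤ C)
    (h : ∀ y, u x + inner ℝ q (y - x) - C * ‖y - x‖ ^ 2 ≤ u y) (ρ : ℝ) :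
    -(C * volume.real (closedBall (0 : H) 1)) * ρ ^ 2 ≤ ballIncrement u ρ x := by
  have h1 : ∫ y in closedBall (0 : H) 1, (ρ * inner ℝ q y - C * ρ ^ 2) ≤ ballIncrement u ρ x := by
    refine setIntegral_mono_on (integrableOn_closedBall_of_continuous (by fun_prop))
      (integrableOn_closedBall_of_continuous (by fun_prop)) measurableSet_closedBall ?_
    intro y hy
    have h2 := h (x + ρ • y)
    rw [mem_closedBall_zero_iff] at hy
    rw [add_sub_cancel_left, inner_smul_right, norm_smul, mul_pow, Real.norm_eq_abs, sq_abs] at h2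
    have h3 : C * (ρ ^ 2 * ‖y‖ ^ 2) ≤ C * (ρ ^ 2 * 1) := by
      have : ‖y‖ ^ 2 ≤ 1 := pow_le_one₀ (norm_nonneg _) hy
      gcongr
    linarith
  rw [integral_sub (integrableOn_closedBall_of_continuous (by fun_prop))
    (integrableOn_closedBall_of_continuous (by fun_prop)), integral_const_mul,
    setIntegral_inner_closedBall, setIntegral_const, smul_eq_mul] at h1
  linarith

/-- Maximum principle on a closed ball, for continuous functions whose ball increments are
asymptotically nonnegative: the center value is at most the boundary value, if the latter is
constant. -/
theorem le_of_ballIncrement_asymptotically_nonneg [Nontrivial H] {V : H → ℝ} (hV : Continuous V)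
    {r : ℝ} (hr : 0 ≤ r) {ρ : ℕ → ℝ} (hρ : ∀ n, 0 < ρ n) (hρ0 : Tendsto ρ atTop (𝓝 0))
    (h : ∀ x, ‖x‖ < r → ∀ η > 0, ∀ᶠ n in atTop, -(η * ρ n ^ 2) ≤ ballIncrement V (ρ n) x)
    {b : ℝ} (hb : ∀ x, ‖x‖ = r → V x = b) : V 0 ≤ b := by
  set c := ∫ y in closedBall (0 : H) 1, ‖y‖ ^ 2 with hc
  have hcpos : 0 < c := setIntegral_norm_sq_closedBall_pos
  have key : ∀ η > 0, V 0 ≤ b + η * r ^ 2 := by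
    intro η hη
    have hW : Continuous fun z => V z + η * ‖z‖ ^ 2 := by fun_prop
    obtain ⟨x, hx, hmax⟩ := (isCompact_closedBall (0 : H) r).exists_isMaxOn
      ⟨0, mem_closedBall_self hr⟩ hW.continuousOn
    rw [mem_closedBall_zero_iff] at hx
    have h0 : V 0 ≤ V x + η * ‖x‖ ^ 2 := by
      simpa using hmax (mem_closedBall_self hr)
    rcases hx.lt_or_eq with hlt | heq
    · exfalso
      have e1 := h x hlt (η * c / 2) (by positivity)
      have e2 : ∀ᶠ n in atTop, ρ n < r - ‖x‖ := hρ0.eventually_lt_const (by linarith)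
      obtain ⟨n, hn1, hn2⟩ := (e1.and e2).exists
      have e3 : ballIncrement (fun z => V z + η * ‖z‖ ^ 2) (ρ n) x ≤ 0 := by
        refine setIntegral_nonpos measurableSet_closedBall fun y hy => ?_
        rw [mem_closedBall_zero_iff] at hy
        have : x + ρ n • y ∈ closedBall (0 : H) r := by
          rw [mem_closedBall_zero_iff]
          calc ‖x + ρ n • y‖ ≤ ‖x‖ + ρ n * ‖y‖ := by
                simpa [norm_smul, abs_of_pos (hρ n)] using norm_add_le x (ρ n • y)
            _ ≤ ‖x‖ + ρ n * 1 := by gcongr; exact (hρ n).le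
            _ ≤ r := by linarith
        exact sub_nonpos.2 (hmax this)
      rw [ballIncrement_add hV (by fun_prop), ballIncrement_const_mul_norm_sq, ← hc] at e3
      have : 0 < η * c * ρ n ^ 2 := by have := hρ n; positivity
      nlinarith
    · rw [hb x heq, heq] at h0
      exact h0
  refine le_of_forall_pos_le_add fun ε hε => ?_
  refine (key (ε / (r ^ 2 + 1)) (by positivity)).trans ?_
  gcongr
  rw [div_mul_eq_mul_div, div_le_iff₀ (by positivity)]
  nlinarith [sq_nonneg r]

/-- Averages of rigid motions commute with ball increments. -/
theorem ballIncrement_integral_isometry {P : Type*} [TopologicalSpace P] [MeasurableSpace P]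
    [OpensMeasurableSpace P] [SecondCountableTopology P] {μ : Measure P} [SFinite μ]
    [IsFiniteMeasureOnCompacts μ] {K : Set P} (hK : IsCompact K)
    (hKm : MeasurableSet K) {u : H → ℝ} (hu : Continuous u)
    (g : P → H ≃ₗᵢ[ℝ] H) (b : P → H) (hg : Continuous fun z : H × P => g z.2 z.1)
    (hb : Continuous b) (ρ : ℝ) (x : H) :
    ballIncrement (fun x => ∫ p in K, u (g p x + b p) ∂μ) ρ x =
      ∫ p in K, ballIncrement u ρ (g p x + b p) ∂μ := by
  have hcont : Continuous fun z : H × P => u (g z.2 z.1 + b z.2) :=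
    hu.comp (hg.add (hb.comp continuous_snd))
  have hint : ∀ x, IntegrableOn (fun p => u (g p x + b p)) K μ := fun x =>
    ContinuousOn.integrableOn_compact' hK hKm
      (hcont.comp (Continuous.prodMk_right x)).continuousOn
  unfold ballIncrement
  simp_rw [← integral_sub (hint _) (hint _)]
  rw [integral_integral_swap]
  · congr 1; ext p
    have h := (g p).measurePreserving.setIntegral_preimage_emb
      (g p).toHomeomorph.measurableEmbedding
      (fun y => u (g p x + b p + ρ • y) - u (g p x + b p)) (closedBall (0 : H) 1)
    have hs : (g p) ⁻¹' closedBall (0 : H) 1 = closedBall 0 1 := by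
      ext; simp
    rw [hs] at h
    rw [← h]
    congr 1; ext y
    rw [map_add, map_smul]; congr 2; abel
  · rw [Measure.prod_restrict]
    have : Continuous fun z : H × P =>
      u (g z.2 (x + ρ • z.1) + b z.2) - u (g z.2 x + b z.2) := by
      have h1 := hcont.comp (f := fun z : H × P => (x + ρ • z.1, z.2)) (by fun_prop)
      have h2 := hcont.comp (f := fun z : H × P => (x, z.2)) (by fun_prop)
      exact h1.sub h2
    exact this.continuousOn.integrableOn_compact' ((isCompact_closedBall 0 1).prod hK)
      (measurableSet_closedBall.prod hKm)

/-- Fatou-type lemma. -/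
theorem eventually_neg_le_integral {P : Type*} [MeasurableSpace P] {μ : Measure P}
    [IsFiniteMeasure μ] {f : ℕ → P → ℝ} (hf : ∀ n, Integrable (f n) μ)
    {ρ : ℕ → ℝ} (hρ : ∀ n, 0 < ρ n) {C : ℝ} (hC : 0 ≤ C)
    (hbound : ∀ n, ∀ᵐ p ∂μ, -C * ρ n ^ 2 ≤ f n p)
    (hlim : ∀ᵐ p ∂μ, ∀ᶠ n in atTop, 0 ≤ f n p) {η : ℝ} (hη : 0 < η) :
    ∀ᶠ n in atTop, -(η * ρ n ^ 2) ≤ ∫ p, f n p ∂μ := by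
  have hi : ∀ n, Integrable (fun p => min (f n p / ρ n ^ 2) 0) μ := fun n =>
    ((hf n).div_const _).inf (integrable_zero _ _ _)
  have ht : Tendsto (fun n => ∫ p, min (f n p / ρ n ^ 2) 0 ∂μ) atTop (𝓝 (∫ _, (0 : ℝ) ∂μ)) := by
    refine tendsto_integral_of_dominated_convergence (fun _ => C)
      (fun n => (hi n).aestronglyMeasurable) (integrable_const C) (fun n => ?_) ?_
    · filter_upwards [hbound n] with p hp
      have := hρ n
      rw [Real.norm_eq_abs, abs_le]
      refine ⟨le_min ?_ (by linarith), (min_le_right _ _).trans hC⟩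
      rw [le_div_iff₀ (by positivity)]
      exact hp
    · filter_upwards [hlim] with p hp
      refine tendsto_const_nhds.congr' ?_
      filter_upwards [hp] with n hn
      rw [min_eq_right (by positivity)]
  rw [integral_zero] at ht
  filter_upwards [ht.eventually_const_le (show -η < 0 by linarith)] with n hn
  have hpos : 0 < ρ n ^ 2 := pow_pos (hρ n) 2
  have h1 : ∫ p, min (f n p / ρ n ^ 2) 0 ∂μ ≤ ∫ p, f n p / ρ n ^ 2 ∂μ :=
    integral_mono (hi n) ((hf n).div_const _) fun p => min_le_left _ _
  rw [integral_div] at h1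
  have h2 := hn.trans h1
  rw [le_div_iff₀ hpos] at h2
  linarith

end SecondDifference

section Rotation

variable {H : Type*} [NormedAddCommGroup H] [InnerProductSpace ℝ H] [FiniteDimensional ℝ H]

instance compactSpace_unitary : CompactSpace (unitary (H →L[ℝ] H)) := by
  have : FiniteDimensional ℝ (H →L[ℝ] H) := inferInstance
  have : ProperSpace (H →L[ℝ] H) := FiniteDimensional.proper ℝ _
  refine (isCompact_iff_compactSpace (s := (unitary (H →L[ℝ] H) : Set (H →L[ℝ] H)))).1 ?_
  refine Metric.isCompact_of_isClosed_isBounded isClosed_unitary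
    (isBounded_closedBall (x := (0 : H →L[ℝ] H)) (r := 1) |>.subset fun g hg => ?_)
  rw [mem_closedBall_zero_iff]
  refine ContinuousLinearMap.opNorm_le_bound _ zero_le_one fun x => ?_
  rw [ContinuousLinearMap.norm_map_of_mem_unitary hg, one_mul]

theorem exists_unitary_apply_eq {x y : H} (h : ‖x‖ = ‖y‖) :
    ∃ g : unitary (H →L[ℝ] H), (g : H →L[ℝ] H) x = y := by
  refine ⟨Unitary.linearIsometryEquiv.symm (Submodule.reflection (ℝ ∙ (x - y))ᗮ), ?_⟩
  exact Submodule.reflection_sub h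

variable [MeasurableSpace H] [BorelSpace H]

/-- A continuous function whose ball increments are bounded below quadratically and are
nonnegative for small radii off a null set has nonnegative ball increments everywhere. -/
theorem ballIncrement_nonneg_of_ae [Nontrivial H] {u : H → ℝ} (hu : Continuous u) {x₀ : H}
    {R C : ℝ} (hC : 0 ≤ C)
    (hlow : ∀ x ∈ ball x₀ R, ∀ ρ, -C * ρ ^ 2 ≤ ballIncrement u ρ x)
    (hae : ∀ᵐ x, x ∈ ball x₀ R → ∀ᶠ ρ in 𝓝[>] (0 : ℝ), 0 ≤ ballIncrement u ρ x)
    {r : ℝ} (hr0 : 0 < r) (hrR : r < R) : 0 ≤ ballIncrement u r x₀ := by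
  let G := unitary (H →L[ℝ] H)
  let _ : MeasurableSpace G := borel G
  have _ : BorelSpace G := ⟨rfl⟩
  have _ : SecondCountableTopology (H →L[ℝ] H) :=
    have : ProperSpace (H →L[ℝ] H) := FiniteDimensional.proper ℝ _
    inferInstance
  have _ : SecondCountableTopology G := inferInstance
  let ν : Measure G := Measure.haar
  let μ : Measure (G × H) := ν.prod volume
  let K : Set (G × H) := univ ×ˢ closedBall 0 1
  have hK : IsCompact K := isCompact_univ.prod (isCompact_closedBall 0 1)
  have hKm : MeasurableSet K := MeasurableSet.univ.prod measurableSet_closedBall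
  have hμK : μ.restrict K = ν.prod (volume.restrict (closedBall 0 1)) := by
    rw [← Measure.prod_restrict, Measure.restrict_univ]
  -- averages over small translations vanish in the limit
  suffices hε : ∀ ε, 0 < ε → ε < R - r →
      0 ≤ ∫ z in closedBall (0 : H) 1, ballIncrement u r (x₀ + ε • z) by
    by_contra! hneg
    have hcont := continuous_ballIncrement hu r
    obtain ⟨δ, hδ, hδ'⟩ := Metric.eventually_nhds_iff.1
      (hcont.continuousAt.eventually_lt_const
        (show ballIncrement u r x₀ < ballIncrement u r x₀ / 2 by linarith))
    obtain ⟨ε, hε0, hε1⟩ := exists_between (show 0 < min δ (R - r) from lt_min hδ (by linarith))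
    have h1 := hε ε hε0 (hε1.trans_le (min_le_right _ _))
    have h2 : ∫ z in closedBall (0 : H) 1, ballIncrement u r (x₀ + ε • z) ≤
        ∫ z in closedBall (0 : H) 1, ballIncrement u r x₀ / 2 := by
      refine setIntegral_mono_on (integrableOn_closedBall_of_continuous (by fun_prop))
        (integrableOn_closedBall_of_continuous (by fun_prop)) measurableSet_closedBall ?_
      intro z hz
      refine (hδ' ?_).le
      rw [mem_closedBall_zero_iff] at hz
      rw [dist_self_add_left, norm_smul, Real.norm_eq_abs, abs_of_pos hε0]
      calc ε * ‖z‖ ≤ ε * 1 := by gcongr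
        _ < δ := by rw [mul_one]; exact hε1.trans_le (min_le_left _ _)
    rw [setIntegral_const, smul_eq_mul] at h2
    have h3 : 0 < volume.real (closedBall (0 : H) 1) :=
      ENNReal.toReal_pos (measure_closedBall_pos _ _ one_pos).ne' measure_closedBall_lt_top.ne
    nlinarith
  intro ε hε0 hεR
  let g : G × H → H ≃ₗᵢ[ℝ] H := fun p => Unitary.linearIsometryEquiv p.1⁻¹
  let b : G × H → H := fun p => x₀ + ε • p.2
  have hg : Continuous fun z : H × (G × H) => g z.2 z.1 := by
    change Continuous fun z : H × (G × H) => ((z.2.1⁻¹ : G) : H →L[ℝ] H) z.1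
    fun_prop
  have hb : Continuous b := by fun_prop
  let V : H → ℝ := fun x => ∫ p in K, u (g p x + b p) ∂μ
  have hV : Continuous V := by
    refine continuous_parametric_integral_of_continuous (μ := μ)
      (f := fun x p => u (g p x + b p)) ?_ hK
    exact hu.comp (hg.add (hb.comp continuous_snd))
  have hVinc : ∀ ρ x, ballIncrement V ρ x = ∫ p in K, ballIncrement u ρ (g p x + b p) ∂μ :=
    fun ρ x => ballIncrement_integral_isometry hK hKm hu g b hg hb ρ x
  have hVrad : ∀ x y, ‖x‖ = ‖y‖ → V x = V y := by
    intro x y hxy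
    obtain ⟨h, rfl⟩ := exists_unitary_apply_eq hxy
    have hint : ∀ x, Integrable (fun p => u (g p x + b p))
        (ν.prod (volume.restrict (closedBall 0 1))) := by
      intro x
      rw [← hμK]
      refine ContinuousOn.integrableOn_compact' hK hKm (Continuous.continuousOn ?_)
      exact hu.comp ((hg.comp (Continuous.prodMk_right x)).add hb)
    simp only [V]
    rw [hμK, integral_prod _ (hint _), integral_prod _ (hint _)]
    refine Eq.trans ?_ (integral_mul_left_eq_self _ h)
    congr 1; ext k
    congr 1; ext z
    congr 2
    simp only [g, mul_inv_rev, map_mul, LinearIsometryEquiv.coe_mul, Function.comp_apply]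
    congr 1
    simp only [map_inv]
    exact ((Unitary.linearIsometryEquiv h).symm_apply_apply x).symm
  have hmem : ∀ x : H, ‖x‖ < R - ε → ∀ p ∈ K, g p x + b p ∈ ball x₀ R := by
    intro x hx p hp
    have hp2 : ‖p.2‖ ≤ 1 := by simpa [K] using hp
    rw [mem_ball, dist_eq_norm]
    calc ‖g p x + b p - x₀‖ = ‖g p x + ε • p.2‖ := by simp only [b]; congr 1; abel
      _ ≤ ‖x‖ + ε * ‖p.2‖ := by
        simpa [norm_smul, abs_of_pos hε0] using norm_add_le (g p x) (ε • p.2)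
      _ ≤ ‖x‖ + ε * 1 := by gcongr
      _ < R := by linarith
  have hasym : ∀ x, ‖x‖ < R - ε → ∀ η > 0, ∀ᶠ n : ℕ in atTop,
      -(η * (1 / ((n : ℝ) + 1)) ^ 2) ≤ ballIncrement V (1 / ((n : ℝ) + 1)) x := by
    intro x hx η hη
    simp_rw [hVinc]
    have hq : Continuous fun p => g p x + b p := (hg.comp (Continuous.prodMk_right x)).add hb
    have : IsFiniteMeasure (μ.restrict K) := ⟨by
      rw [Measure.restrict_apply_univ]; exact hK.measure_lt_top⟩
    refine eventually_neg_le_integral (C := C)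
      (f := fun (n : ℕ) p => ballIncrement u (1 / ((n : ℝ) + 1)) (g p x + b p))
      (fun n => ?_) (fun n => by positivity) hC (fun n => ?_) ?_ hη
    · exact ((continuous_ballIncrement hu _).comp hq).continuousOn.integrableOn_compact' hK hKm
    · filter_upwards [ae_restrict_mem hKm] with p hp
      exact hlow _ (hmem x hx p hp) _
    · have hqmp : ∀ᵐ p ∂μ, g p x + b p ∈ ball x₀ R →
          ∀ᶠ ρ in 𝓝[>] (0 : ℝ), 0 ≤ ballIncrement u ρ (g p x + b p) := by
        obtain ⟨N, hN, hNm, hN0⟩ := exists_measurable_superset_of_null (ae_iff.1 hae)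
        have hpre : μ ((fun p => g p x + b p) ⁻¹' N) = 0 := by
          refine (Measure.measure_prod_null (hq.measurable hNm)).2 (ae_of_all _ fun k => ?_)
          have hset : Prod.mk k ⁻¹' ((fun p => g p x + b p) ⁻¹' N) =
              (fun z : H => ε • z) ⁻¹' ((fun z => (g (k, 0) x + x₀) + z) ⁻¹' N) := by
            ext z
            simp only [mem_preimage, g, b, add_assoc]
          change volume (Prod.mk k ⁻¹' ((fun p => g p x + b p) ⁻¹' N)) = 0
          rw [hset, Measure.addHaar_preimage_smul _ hε0.ne', measure_preimage_add, hN0, mul_zero]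
        refine measure_mono_null (fun p hp => ?_) hpre
        exact hN hp
      filter_upwards [ae_restrict_mem hKm, ae_restrict_of_ae hqmp] with p hp hp'
      refine (tendsto_nhdsWithin_iff.2 ⟨tendsto_one_div_add_atTop_nhds_zero_nat,
        Eventually.of_forall fun n => ?_⟩).eventually (hp' (hmem x hx p hp))
      change (0 : ℝ) < 1 / ((n : ℝ) + 1)
      positivity
  have hmax : ∀ x, ‖x‖ ≤ r → V 0 ≤ V x := by
    intro x hx
    refine le_of_ballIncrement_asymptotically_nonneg hV (norm_nonneg x)
      (ρ := fun n : ℕ => 1 / ((n : ℝ) + 1)) (fun n => by positivity)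
      tendsto_one_div_add_atTop_nhds_zero_nat ?_ fun y hy => hVrad y x hy
    intro y hy η hη
    exact hasym y (by linarith) η hη
  have h1 : 0 ≤ ballIncrement V r 0 := by
    refine setIntegral_nonneg measurableSet_closedBall fun y hy => sub_nonneg.2 (hmax _ ?_)
    rw [mem_closedBall_zero_iff] at hy
    rw [zero_add, norm_smul, Real.norm_eq_abs, abs_of_pos hr0]
    nlinarith
  rw [hVinc, hμK] at h1
  simp only [map_zero, zero_add, b] at h1
  rw [integral_fun_snd (fun z => ballIncrement u r (x₀ + ε • z))] at h1
  have hν : 0 < ν.real univ := ENNReal.toReal_pos (NeZero.ne _) (measure_ne_top _ _)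
  exact nonneg_of_mul_nonneg_right h1 hν

end Rotation

section Distance

variable {H : Type*} [NormedAddCommGroup H] [InnerProductSpace ℝ H] [FiniteDimensional ℝ H]

/-- The negated distance function to a closed set is supported from below by a quadratic
function at each point off the set. -/
theorem exists_quadratic_le_neg_infDist {F : Set H} (hF : IsClosed F) (hne : F.Nonempty) {x : H}
    {δ : ℝ} (hδ : 0 < δ) (hx : δ ≤ infDist x F) :
    ∃ q : H, ∀ y, -infDist x F + inner ℝ q (y - x) - (2 * δ)⁻¹ * ‖y - x‖ ^ 2 ≤ -infDist y F := by
  obtain ⟨z, hz, hxz⟩ := hF.exists_infDist_eq_dist hne x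
  set D := infDist x F
  have hD : 0 < D := hδ.trans_le hx
  refine ⟨-D⁻¹ • (x - z), fun y => ?_⟩
  have h1 : infDist y F ≤ ‖y - z‖ := by simpa [dist_eq_norm] using infDist_le_dist_of_mem hz
  have h2 : ‖y - z‖ ^ 2 = ‖y - x‖ ^ 2 + 2 * inner ℝ (x - z) (y - x) + D ^ 2 := by
    rw [hxz, dist_eq_norm, show y - z = (y - x) + (x - z) by abel, norm_add_sq_real,
      real_inner_comm]
  have h3 : ‖y - z‖ ≤ (2 * D)⁻¹ * (‖y - z‖ ^ 2 + D ^ 2) := by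
    rw [le_inv_mul_iff₀ (by positivity)]
    nlinarith [sq_nonneg (‖y - z‖ - D)]
  have h4 : (2 * D)⁻¹ * (‖y - z‖ ^ 2 + D ^ 2) =
      D + D⁻¹ * inner ℝ (x - z) (y - x) + (2 * D)⁻¹ * ‖y - x‖ ^ 2 := by
    rw [h2]; field_simp; ring
  have h5 : (2 * D)⁻¹ * ‖y - x‖ ^ 2 ≤ (2 * δ)⁻¹ * ‖y - x‖ ^ 2 := by gcongr
  rw [inner_smul_left]
  simp only [conj_trivial]
  linarith

variable [MeasurableSpace H] [BorelSpace H]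

theorem setIntegral_ball_eq_closedBall [Nontrivial H] (f : H → ℝ) (x : H) {r : ℝ} (hr : 0 < r) :
    ∫ y in ball x r, f y =
      r ^ Module.finrank ℝ H * ∫ y in closedBall (0 : H) 1, f (x + r • y) := by
  have h1 : ∫ y in closedBall (0 : H) 1, f (x + r • y) =
      (r ^ Module.finrank ℝ H)⁻¹ * ∫ y in closedBall (0 : H) r, f (x + y) := by
    rw [Measure.setIntegral_comp_smul_of_pos volume (fun y => f (x + y)) _ hr,
      smul_unitClosedBall_of_nonneg hr.le, smul_eq_mul]
  have h2 : ∫ y in closedBall (0 : H) r, f (x + y) = ∫ y in closedBall x r, f y := by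
    rw [← (measurePreserving_add_left volume x).setIntegral_preimage_emb
      (measurableEmbedding_addLeft x) f (closedBall x r)]
    simp
  have h3 : (closedBall x r : Set H) =ᵐ[volume] ball x r := by
    rw [← ball_union_sphere]
    exact union_ae_eq_left_of_ae_eq_empty (ae_eq_empty.2 (Measure.addHaar_sphere _ _ _))
  rw [h1, h2, setIntegral_congr_set h3, mul_inv_cancel_left₀ (by positivity)]

theorem le_erealBallAvg_neg_iff [Nontrivial H] {f : H → ℝ} (hf : Continuous f)
    (hf0 : ∀ x, 0 ≤ f x) (x : H) {r : ℝ} (hr : 0 < r) :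
    ((-f x : ℝ) : EReal) ≤ erealBallAvg (fun y => ((-f y : ℝ) : EReal)) x r ↔
      0 ≤ ballIncrement (fun y => -f y) r x := by
  have h0 : ∀ y, erealToENNReal ((-f y : ℝ) : EReal) = 0 := fun y => by
    rw [erealToENNReal, if_neg (EReal.coe_ne_top _), EReal.toReal_coe,
      ENNReal.ofReal_of_nonpos (neg_nonpos.2 (hf0 y))]
  have h1 : ∀ y, erealToENNReal (-((-f y : ℝ) : EReal)) = ENNReal.ofReal (f y) := fun y => by
    rw [← EReal.coe_neg, neg_neg, erealToENNReal, if_neg (EReal.coe_ne_top _), EReal.toReal_coe]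
  have hint : IntegrableOn f (ball x r) :=
    (hf.continuousOn.integrableOn_compact (isCompact_closedBall x r)).mono_set
      ball_subset_closedBall
  have hv : 0 < volume.real (ball x r) :=
    ENNReal.toReal_pos (measure_ball_pos _ _ hr).ne' measure_ball_lt_top.ne
  have havg : erealBallAvg (fun y => ((-f y : ℝ) : EReal)) x r =
      ((-((∫ y in ball x r, f y) / volume.real (ball x r)) : ℝ) : EReal) := by
    unfold erealBallAvg
    simp_rw [h0, h1]
    rw [← ofReal_integral_eq_lintegral_ofReal hint (ae_of_all _ hf0),
      ← ofReal_measureReal measure_ball_lt_top.ne, ← ENNReal.ofReal_div_of_pos hv,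
      lintegral_zero, ENNReal.zero_div, EReal.coe_ennreal_zero, zero_sub,
      EReal.coe_ennreal_ofReal, max_eq_left (div_nonneg (integral_nonneg hf0) hv.le),
      EReal.coe_neg]
  rw [havg, EReal.coe_le_coe_iff, neg_le_neg_iff, div_le_iff₀ hv]
  have hvol : volume.real (ball x r) =
      r ^ Module.finrank ℝ H * volume.real (closedBall (0 : H) 1) := by
    simpa using setIntegral_ball_eq_closedBall (fun _ => (1 : ℝ)) x hr
  rw [setIntegral_ball_eq_closedBall f x hr, hvol, mul_left_comm,
    mul_le_mul_iff_right₀ (by positivity)]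
  unfold ballIncrement
  rw [integral_sub (integrableOn_closedBall_of_continuous (by fun_prop))
    (integrableOn_closedBall_of_continuous (by fun_prop)), integral_neg, setIntegral_const,
    smul_eq_mul]
  constructor <;> intro h <;> linarith

end Distance

/-- Theorem (statement 10): let `Ω ⊊ ℝᵐ` be a domain and `E ⊆ Ω` a closed subset of `Ω` of
Lebesgue measure zero. If `x ↦ -d_{∂Ω}(x)` is subharmonic on `Ω \ E`, then it is subharmonic
on all of `Ω`. -/
theorem negDist_subharmonic_extend (m : ℕ) (Ω : Set (EuclideanSpace ℝ (Fin m)))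
    (hopen : IsOpen Ω) (hconn : IsConnected Ω) (hne : Ω ≠ Set.univ)
    (Ecl : Set (EuclideanSpace ℝ (Fin m))) (hEsub : Ecl ⊆ Ω)
    (hEclosed : IsOpen (Ω \ Ecl)) (hEnull : volume Ecl = 0)
    (hsub : IsSubharmonicOn
      (fun x => ((- infDist x (frontier Ω) : ℝ) : EReal)) (Ω \ Ecl)) :
    IsSubharmonicOn (fun x => ((- infDist x (frontier Ω) : ℝ) : EReal)) Ω := by
  have hfr : (frontier Ω).Nonempty := by
    rw [nonempty_iff_ne_empty, Ne, ← isClopen_iff_frontier_eq_empty, isClopen_iff]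
    exact not_or.2 ⟨hconn.nonempty.ne_empty, hne⟩
  obtain ⟨z, hz⟩ := hconn.nonempty
  have hnt : Nontrivial (EuclideanSpace ℝ (Fin m)) := by
    obtain ⟨w, hw⟩ := (ne_univ_iff_exists_notMem _).1 hne
    exact ⟨w, z, fun h => hw (h ▸ hz)⟩
  set f : EuclideanSpace ℝ (Fin m) → ℝ := fun x => infDist x (frontier Ω)
  have hf : Continuous f := continuous_infDist_pt _
  have hf0 : ∀ x, 0 ≤ f x := fun x => infDist_nonneg
  have hcont : Continuous fun x => ((-f x : ℝ) : EReal) :=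
    continuous_coe_real_ereal.comp hf.neg
  refine ⟨hcont.upperSemicontinuous.upperSemicontinuousOn _, fun h => EReal.coe_ne_bot _ (h z hz),
    fun x _ => EReal.coe_lt_top _, fun x₀ hx₀ => ?_⟩
  have hpos : 0 < f x₀ := by
    refine (isClosed_frontier.notMem_iff_infDist_pos hfr).1 fun hx => ?_
    rw [hopen.frontier_eq] at hx
    exact hx.2 hx₀
  obtain ⟨R₁, hR₁, hball⟩ := Metric.isOpen_iff.1 hopen x₀ hx₀
  refine ⟨min R₁ (f x₀ / 2), lt_min hR₁ (by linarith), fun r hr hrR _ => ?_⟩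
  rw [le_erealBallAvg_neg_iff hf hf0 x₀ hr]
  refine ballIncrement_nonneg_of_ae hf.neg (R := min R₁ (f x₀ / 2))
    (C := (2 * (f x₀ / 2))⁻¹ * volume.real (closedBall (0 : EuclideanSpace ℝ (Fin m)) 1))
    (by positivity) (fun x hx ρ => ?_) ?_ hr hrR
  · have h1 : f x₀ / 2 ≤ f x := by
      have h2 : f x₀ ≤ f x + dist x₀ x := infDist_le_infDist_add_dist
      have h3 : dist x x₀ < f x₀ / 2 := (mem_ball.1 hx).trans_le (min_le_right _ _)
      rw [dist_comm] at h3
      linarith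
    obtain ⟨q, hq⟩ := exists_quadratic_le_neg_infDist isClosed_frontier hfr
      (by linarith : 0 < f x₀ / 2) h1
    exact neg_le_ballIncrement hf.neg (by positivity) hq ρ
  · filter_upwards [measure_eq_zero_iff_ae_notMem.1 hEnull] with x hxE hx
    have hxΩ : x ∈ Ω \ Ecl := ⟨hball (ball_subset_ball (min_le_left _ _) hx), hxE⟩
    obtain ⟨R, hR, hmean⟩ := hsub.2.2.2 x hxΩ
    obtain ⟨R', hR', hball'⟩ := Metric.isOpen_iff.1 hEclosed x hxΩ
    filter_upwards [Ioo_mem_nhdsGT (lt_min hR hR')] with ρ hρ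
    refine (le_erealBallAvg_neg_iff hf hf0 x hρ.1).1 ?_
    exact hmean ρ hρ.1 (hρ.2.trans_le (min_le_left _ _))
      ((closedBall_subset_ball (hρ.2.trans_le (min_le_right _ _))).trans hball')

end
end
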